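/- (Dimension of the tangent space to the Chow variety at a generic point) Let k be an algebraically closed field of characteristic 0, and let n ≥ 1, d ≥ 1. There exist homogeneous degree-1 polynomials ℓ_1, …, ℓ_d in k[x_0,…,x_n] such that the span of the set of degree-d homogeneous polynomials { x_m · ∏_{i≠j} ℓ_i : 0 ≤ m ≤ n, 1 ≤ j ≤ d } has dimension exactly d·n + 1. -/

import Mathlib

open MvPolynomial

/-- The linear form `x_0 + a x_1`. -/
noncomputable def pencilForm (k : Type*) [Field k] (N : ℕ) (a : k) :
    MvPolynomial (Fin (N + 2)) k :=
  X 0 + a • X 1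

/-- The spanning family of the tangent space at `∏ (x_0 + a_i x_1)` consisting of the product
itself and of the `x_m ∏_{i ≠ j} (x_0 + a_i x_1)` with `m ≠ 0`. -/
noncomputable def pencilBasis {k : Type*} [Field k] {N d : ℕ} (a : Fin d → k) :
    Option (Fin (N + 1) × Fin d) → MvPolynomial (Fin (N + 2)) k
  | none => ∏ i, pencilForm k N (a i)
  | some (m, j) => X m.succ * ∏ i ∈ Finset.univ.erase j, pencilForm k N (a i)

theorem pencilForm_isHomogeneous {k : Type*} [Field k] (N : ℕ) (a : k) :
    (pencilForm k N a).IsHomogeneous 1 := by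
  rw [pencilForm, smul_eq_C_mul]
  exact (isHomogeneous_X k 0).add (by simpa using (isHomogeneous_C _ a).mul (isHomogeneous_X k 1))

theorem pencilForm_ne_zero {k : Type*} [Field k] (N : ℕ) (a : k) : pencilForm k N a ≠ 0 := by
  intro h
  have := congrArg (eval (Pi.single 0 1)) h
  simp [pencilForm, smul_eval] at this

/-- Substitution of `-a x_1` for `x_0`. -/
noncomputable def pencilSubst (k : Type*) [Field k] (N : ℕ) (a : k) :
    MvPolynomial (Fin (N + 2)) k →ₐ[k] MvPolynomial (Fin (N + 2)) k :=
  aeval (Fin.cons (-(a • X 1)) fun m => X m.succ)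

theorem pencilSubst_X_succ {k : Type*} [Field k] {N : ℕ} (a : k) (m : Fin (N + 1)) :
    pencilSubst k N a (X m.succ) = X m.succ := by
  simp [pencilSubst]

theorem pencilSubst_pencilForm {k : Type*} [Field k] {N : ℕ} (a b : k) :
    pencilSubst k N a (pencilForm k N b) = (b - a) • X 1 := by
  have h := pencilSubst_X_succ (N := N) a 0
  rw [Fin.succ_zero_eq_one] at h
  rw [pencilForm, map_add, map_smul, h]
  simp only [pencilSubst, aeval_X, Fin.cons_zero]
  module

theorem linearIndependent_pencilBasis {k : Type*} [Field k] {N d : ℕ} {a : Fin d → k}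
    (ha : Function.Injective a) : LinearIndependent k (pencilBasis (N := N) a) := by
  rw [Fintype.linearIndependent_iff]
  intro g hg
  rw [Fintype.sum_option, Fintype.sum_prod_type_right] at hg
  simp only [pencilBasis] at hg
  have hsome : ∀ j m, g (some (m, j)) = 0 := by
    intro j
    have h := congrArg (pencilSubst k N (a j)) hg
    simp only [map_add, map_sum, map_smul, map_mul, map_prod, map_zero,
      pencilSubst_pencilForm, pencilSubst_X_succ] at h
    rw [Finset.prod_eq_zero (Finset.mem_univ j) (by simp), smul_zero, zero_add,
      Finset.sum_eq_single j] at h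
    · simp only [← smul_mul_assoc, ← Finset.sum_mul] at h
      have hprod : ∏ i ∈ Finset.univ.erase j,
          (a i - a j) • (X 1 : MvPolynomial (Fin (N + 2)) k) ≠ 0 :=
        Finset.prod_ne_zero_iff.2 fun i hi => smul_ne_zero
          (sub_ne_zero.2 (ha.ne (Finset.ne_of_mem_erase hi))) (X_ne_zero _)
      have hX : LinearIndependent k fun m : Fin (N + 1) =>
          (X m.succ : MvPolynomial (Fin (N + 2)) k) :=
        (linearIndependent_X (Fin (N + 2)) k).comp _ (Fin.succ_injective _)
      exact Fintype.linearIndependent_iff.1 hX _ ((mul_eq_zero.1 h).resolve_right hprod)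
    · intro i _ hij
      refine Finset.sum_eq_zero fun m _ => ?_
      rw [Finset.prod_eq_zero (Finset.mem_erase.2 ⟨hij.symm, Finset.mem_univ j⟩) (by simp),
        mul_zero, smul_zero]
    · simp
  rintro (_ | ⟨m, j⟩)
  · simp only [hsome, zero_smul, Finset.sum_const_zero, add_zero] at hg
    exact (smul_eq_zero.1 hg).resolve_right
      (Finset.prod_ne_zero_iff.2 fun i _ => pencilForm_ne_zero N _)
  · exact hsome j m

theorem X_zero_mul_prod_erase {k : Type*} [Field k] {N d : ℕ} (a : Fin d → k) (j : Fin d) :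
    X 0 * ∏ i ∈ Finset.univ.erase j, pencilForm k N (a i) =
      pencilBasis a none - a j • pencilBasis a (some (0, j)) := by
  simp only [pencilBasis]
  rw [← Finset.mul_prod_erase Finset.univ _ (Finset.mem_univ j), Fin.succ_zero_eq_one]
  generalize ∏ i ∈ Finset.univ.erase j, pencilForm k N (a i) = q
  rw [pencilForm, add_mul, smul_mul_assoc, add_sub_cancel_right]

theorem span_eq_span_range_pencilBasis {k : Type*} [Field k] {N d : ℕ} (hd : 1 ≤ d)
    (a : Fin d → k) :
    Submodule.span k {p : MvPolynomial (Fin (N + 2)) k | ∃ m : Fin (N + 2), ∃ j : Fin d,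
        p = X m * ∏ i ∈ Finset.univ.erase j, pencilForm k N (a i)} =
      Submodule.span k (Set.range (pencilBasis (N := N) a)) := by
  have hmem : ∀ x, pencilBasis a x ∈ Submodule.span k (Set.range (pencilBasis (N := N) a)) :=
    fun x => Submodule.subset_span (Set.mem_range_self x)
  apply le_antisymm <;> rw [Submodule.span_le]
  · rintro _ ⟨m, j, rfl⟩
    refine Fin.cases ?_ (fun m => ?_) m
    · rw [X_zero_mul_prod_erase]
      exact sub_mem (hmem _) (Submodule.smul_mem _ _ (hmem _))
    · exact hmem (some (m, j))
  · have hsome : ∀ m j, pencilBasis a (some (m, j)) ∈ Submodule.span k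
        {p : MvPolynomial (Fin (N + 2)) k | ∃ m : Fin (N + 2), ∃ j : Fin d,
          p = X m * ∏ i ∈ Finset.univ.erase j, pencilForm k N (a i)} :=
      fun m j => Submodule.subset_span ⟨m.succ, j, rfl⟩
    rintro _ ⟨_ | ⟨m, j⟩, rfl⟩
    · rw [SetLike.mem_coe, ← sub_add_cancel (pencilBasis a none)
        (a ⟨0, hd⟩ • pencilBasis a (some (0, ⟨0, hd⟩))), ← X_zero_mul_prod_erase]
      exact add_mem (Submodule.subset_span ⟨0, _, rfl⟩) (Submodule.smul_mem _ _ (hsome _ _))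
    · exact hsome m j

/-- Dimension of the tangent space to the Chow variety at a generic point: over an
algebraically closed field of characteristic 0, there exist linear forms
`ℓ_1, …, ℓ_d` such that the span of `{ x_m · ∏_{i≠j} ℓ_i }` has dimension `d·n + 1`. -/
theorem chow_tangent_space_dimension
    {k : Type*} [Field k] [IsAlgClosed k] [CharZero k]
    (n d : ℕ) (hn : 1 ≤ n) (hd : 1 ≤ d) :
    ∃ l : Fin d → MvPolynomial (Fin (n + 1)) k,
      (∀ j, (l j).IsHomogeneous 1) ∧
      Module.finrank k ↥(Submodule.span k
        {p : MvPolynomial (Fin (n + 1)) k | ∃ m : Fin (n + 1), ∃ j : Fin d,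
          p = MvPolynomial.X m * ∏ i ∈ Finset.univ.erase j, l i}) = d * n + 1 := by
  obtain ⟨N, rfl⟩ := Nat.exists_eq_add_of_le' hn
  have ha : Function.Injective fun i : Fin d => ((i : ℕ) : k) :=
    Nat.cast_injective.comp Fin.val_injective
  refine ⟨fun i => pencilForm k N (i : ℕ), fun j => pencilForm_isHomogeneous N _, ?_⟩
  rw [span_eq_span_range_pencilBasis hd fun i : Fin d => ((i : ℕ) : k),
    finrank_span_eq_card (linearIndependent_pencilBasis ha)]
  simp [mul_comm]
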